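/- Fix an integer d ≥ 2 and reals m > 0 and z > 0. Then the Lebesgue integral over ℝ^d of the function p ↦ exp(−(z/m)·√(m² + ‖p‖²)) · (m² + ‖p‖²)^{−1/2} equals 2·(2π m²/z)^{(d−1)/2} · K_{(d−1)/2}(z). (This is the generating function Z of the Jüttner equilibrium distribution with α = 1, computed in the rest frame where the future mass shell is parametrized by p ∈ ℝ^d with p⁰ = √(m² + ‖p‖²) and invariant volume element d^d p / p⁰.) -/

import Mathlib

open MeasureTheory Real Filter

/-- The modified Bessel function of the second kind, defined via its integral
representation `K_ν(z) = ∫_0^∞ exp(−z cosh t) cosh(ν t) dt`. -/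
noncomputable def besselK (ν z : ℝ) : ℝ :=
  ∫ t in Set.Ioi (0:ℝ), Real.exp (-z * Real.cosh t) * Real.cosh (ν * t)

lemma besselK_neg (ν z : ℝ) : besselK (-ν) z = besselK ν z := by
  simp [besselK]

lemma integrable_exp_neg_exp_add_exp_neg {A B : ℝ} (hA : 0 < A) (hB : 0 < B) (ν : ℝ) :
    Integrable fun t : ℝ ↦ exp (-(A * exp t + B * exp (-t))) * exp (ν * t) := by
  obtain ⟨δ, hδ, hδA, hδB⟩ : ∃ δ : ℝ, 0 < δ ∧ δ ≤ A ∧ δ ≤ B :=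
    ⟨min A B, lt_min hA hB, min_le_left _ _, min_le_right _ _⟩
  have hg : Integrable fun t : ℝ ↦ exp (ν ^ 2 / δ) * exp (-(δ / 4) * t ^ 2) :=
    (integrable_exp_neg_mul_sq (by positivity)).const_mul _
  refine hg.mono' (by fun_prop) (ae_of_all _ fun t ↦ ?_)
  rw [norm_of_nonneg (by positivity), ← exp_add, ← exp_add, exp_le_exp]
  have hsq : δ * (t ^ 2 / 2) ≤ A * exp t + B * exp (-t) := by
    have hA' : δ * exp t ≤ A * exp t := by gcongr
    have hB' : δ * exp (-t) ≤ B * exp (-t) := by gcongr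
    have : t ^ 2 / 2 ≤ exp t + exp (-t) := by
      rcases le_total 0 t with h | h
      · have := quadratic_le_exp_of_nonneg h
        have := exp_pos (-t)
        linarith
      · have := quadratic_le_exp_of_nonneg (neg_nonneg.mpr h)
        have := exp_pos t
        nlinarith
    nlinarith
  have hν : ν * t ≤ ν ^ 2 / δ + δ / 4 * t ^ 2 := by
    have : ν ^ 2 / δ + δ / 4 * t ^ 2 - ν * t = (ν - δ * t / 2) ^ 2 / δ := by
      field_simp
      ring
    have : 0 ≤ (ν - δ * t / 2) ^ 2 / δ := by positivity
    linarith
  linarith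

lemma integral_exp_neg_mul_cosh_mul_cosh (ν z : ℝ) :
    ∫ t : ℝ, exp (-z * cosh t) * cosh (ν * t) = 2 * besselK ν z := by
  rw [besselK, ← integral_comp_abs]
  refine integral_congr_ae (ae_of_all _ fun t ↦ ?_)
  rcases abs_choice t with h | h <;> simp [h]

lemma integral_exp_neg_mul_cosh_mul_exp {z : ℝ} (hz : 0 < z) (ν : ℝ) :
    ∫ t : ℝ, exp (-z * cosh t) * exp (ν * t) = 2 * besselK ν z := by
  have hint (μ : ℝ) : Integrable fun t : ℝ ↦ exp (-z * cosh t) * exp (μ * t) := by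
    convert! integrable_exp_neg_exp_add_exp_neg (half_pos hz) (half_pos hz) μ using 4 with t
    rw [cosh_eq]
    ring
  have hneg : ∫ t : ℝ, exp (-z * cosh t) * exp (-ν * t)
      = ∫ t : ℝ, exp (-z * cosh t) * exp (ν * t) := by
    rw [← integral_neg_eq_self]
    simp
  have hsum := integral_add (hint ν) (hint (-ν))
  rw [hneg] at hsum
  have hcosh : ∫ t : ℝ, (exp (-z * cosh t) * exp (ν * t) + exp (-z * cosh t) * exp (-ν * t))
      = 2 * ∫ t : ℝ, exp (-z * cosh t) * cosh (ν * t) := by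
    rw [← integral_const_mul]
    congr with t
    rw [cosh_eq (ν * t)]
    ring_nf
  rw [hcosh, integral_exp_neg_mul_cosh_mul_cosh] at hsum
  linarith

lemma integral_exp_neg_exp_add_exp_neg {a b : ℝ} (ha : 0 < a) (hb : 0 < b) (ν : ℝ) :
    ∫ t : ℝ, exp (-(a ^ 2 * exp t + b ^ 2 * exp (-t))) * exp (ν * t)
      = 2 * (b / a) ^ ν * besselK ν (2 * a * b) := by
  rw [← integral_add_right_eq_self _ (log (b / a)), mul_assoc, mul_left_comm,
    ← integral_exp_neg_mul_cosh_mul_exp (by positivity), ← integral_const_mul]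
  congr with t
  have hexp : exp (-(t + log (b / a))) = exp (-t) * (a / b) := by
    rw [neg_add, exp_add, exp_neg (log (b / a)), exp_log (by positivity), inv_div]
  have hquad : a ^ 2 * exp (t + log (b / a)) + b ^ 2 * exp (-(t + log (b / a)))
      = 2 * a * b * cosh t := by
    rw [hexp, exp_add, exp_log (by positivity), cosh_eq]
    field_simp
  rw [hquad, mul_add, exp_add, rpow_def_of_pos (by positivity), mul_comm ν (log (b / a)), neg_mul]
  ring

lemma besselK_one_half (z : ℝ) :
    besselK (1 / 2) z = √(π / (2 * z)) * exp (-z) := by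
  have hsub := integral_image_eq_integral_abs_deriv_smul (s := Set.univ) (f := fun t ↦ sinh (t / 2))
    (f' := fun t ↦ cosh (t / 2) * (1 / 2)) MeasurableSet.univ
    (fun t _ ↦ (((hasDerivAt_id t).div_const 2).sinh).hasDerivWithinAt)
    (fun x _ y _ h ↦ by have := sinh_injective h; linarith)
    (fun w ↦ exp (-(2 * z) * w ^ 2))
  have himage : (fun t ↦ sinh (t / 2)) '' Set.univ = Set.univ := by
    rw [Set.image_univ, Set.range_eq_univ]
    intro w
    obtain ⟨t, ht⟩ := sinh_surjective w
    exact ⟨2 * t, by simpa using ht⟩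
  rw [himage, setIntegral_univ, setIntegral_univ, integral_gaussian] at hsub
  have hfull := integral_exp_neg_mul_cosh_mul_cosh (1 / 2) z
  have heq : ∫ t : ℝ, exp (-z * cosh t) * cosh (1 / 2 * t)
      = 2 * exp (-z) *
        ∫ t : ℝ, |cosh (t / 2) * (1 / 2)| • exp (-(2 * z) * sinh (t / 2) ^ 2) := by
    rw [← integral_const_mul]
    congr with t
    have hcosh : cosh t = 1 + 2 * sinh (t / 2) ^ 2 := by
      have h := cosh_two_mul (t / 2)
      rw [mul_div_cancel₀ t two_ne_zero, cosh_sq] at h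
      linarith
    have : 0 < cosh (t / 2) := cosh_pos _
    rw [hcosh, abs_of_pos (by positivity), smul_eq_mul, mul_add, exp_add]
    ring_nf
  rw [heq, ← hsub] at hfull
  linarith

lemma exp_neg_mul_div_eq_integral {s b : ℝ} (hs : 0 < s) (hb : 0 < b) :
    exp (-(2 * b) * s) / s
      = (√π)⁻¹ * ∫ t : ℝ, exp (-(s ^ 2 * exp t + b ^ 2 * exp (-t))) * exp (1 / 2 * t) := by
  rw [integral_exp_neg_exp_add_exp_neg hs hb, besselK_one_half, ← sqrt_eq_rpow]
  have hsqrt : √(b / s) * √(π / (2 * (2 * s * b))) = √π / (2 * s) := by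
    rw [← sqrt_mul (by positivity), ← sqrt_sq (show 0 ≤ 2 * s by positivity),
      ← sqrt_div (by positivity)]
    congr 1
    rw [sqrt_sq (by positivity)]
    field_simp
  have hπ : √π ≠ 0 := by positivity
  calc exp (-(2 * b) * s) / s
      = (√π)⁻¹ * (2 * (√π / (2 * s)) * exp (-(2 * s * b))) := by
        field_simp
    _ = _ := by
        rw [← hsqrt]
        ring

lemma integrable_exp_neg_mul_norm_sq {V : Type*} [NormedAddCommGroup V] [InnerProductSpace ℝ V]
    [FiniteDimensional ℝ V] [MeasurableSpace V] [BorelSpace V] {b : ℝ} (hb : 0 < b) :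
    Integrable fun v : V ↦ exp (-b * ‖v‖ ^ 2) := by
  refine not_imp_comm.mp integral_undef ?_
  rw [GaussianFourier.integral_rexp_neg_mul_sq_norm hb]
  positivity

/-- Integrating first over `v` turns a Gaussian superposition into an integral of Bessel type. -/
lemma integral_integral_exp_neg_add_norm_sq {V : Type*} [NormedAddCommGroup V]
    [InnerProductSpace ℝ V] [FiniteDimensional ℝ V] [MeasurableSpace V] [BorelSpace V]
    {A B : ℝ} (hA : 0 < A) (hB : 0 < B) (ν : ℝ) :
    ∫ v : V, ∫ t : ℝ, exp (-((A + ‖v‖ ^ 2) * exp t + B * exp (-t))) * exp (ν * t)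
      = π ^ (Module.finrank ℝ V / 2 : ℝ) * ∫ t : ℝ,
        exp (-(A * exp t + B * exp (-t))) * exp ((ν - Module.finrank ℝ V / 2) * t) := by
  have hfactor (t : ℝ) (v : V) :
      exp (-((A + ‖v‖ ^ 2) * exp t + B * exp (-t))) * exp (ν * t)
        = exp (-(A * exp t + B * exp (-t))) * exp (ν * t) * exp (-exp t * ‖v‖ ^ 2) := by
    rw [← exp_add, ← exp_add, ← exp_add]
    ring_nf
  have hinner (t : ℝ) :
      ∫ v : V, exp (-((A + ‖v‖ ^ 2) * exp t + B * exp (-t))) * exp (ν * t)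
        = π ^ (Module.finrank ℝ V / 2 : ℝ) * (exp (-(A * exp t + B * exp (-t)))
          * exp ((ν - Module.finrank ℝ V / 2) * t)) := by
    simp_rw [hfactor]
    rw [integral_const_mul, GaussianFourier.integral_rexp_neg_mul_sq_norm (exp_pos t),
      div_rpow pi_pos.le (exp_pos t).le, ← exp_mul, sub_mul, exp_sub,
      mul_comm (Module.finrank ℝ V / 2 : ℝ) t]
    ring
  have hswap : Integrable (Function.uncurry fun (t : ℝ) (v : V) ↦
      exp (-((A + ‖v‖ ^ 2) * exp t + B * exp (-t))) * exp (ν * t)) (volume.prod volume) := by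
    refine (integrable_prod_iff (Continuous.aestronglyMeasurable (by fun_prop))).mpr
      ⟨ae_of_all _ fun t ↦ ?_, ?_⟩
    · simp only [Function.uncurry_apply_pair, hfactor]
      exact (integrable_exp_neg_mul_norm_sq (exp_pos t)).const_mul _
    · simp only [Function.uncurry_apply_pair, norm_mul, norm_of_nonneg (exp_pos _).le, hinner]
      exact (integrable_exp_neg_exp_add_exp_neg hA hB _).const_mul _
  rw [← integral_integral_swap hswap]
  simp_rw [hinner]
  rw [integral_const_mul]

/-- The generating function `Z` of the Jüttner distribution (with `α = 1`), computed
in the rest frame: `∫_{ℝ^d} exp(−(z/m)√(m²+‖p‖²)) (m²+‖p‖²)^{−1/2} dp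
= 2 (2π m²/z)^{(d−1)/2} K_{(d−1)/2}(z)`. -/
theorem juttner_generating_function (d : ℕ) (hd : 2 ≤ d) (m z : ℝ)
    (hm : 0 < m) (hz : 0 < z) :
    (∫ p : EuclideanSpace ℝ (Fin d),
        Real.exp (-(z / m) * Real.sqrt (m ^ 2 + ‖p‖ ^ 2)) / Real.sqrt (m ^ 2 + ‖p‖ ^ 2))
      = 2 * (2 * Real.pi * m ^ 2 / z) ^ (((d : ℝ) - 1) / 2)
          * besselK (((d : ℝ) - 1) / 2) z := by
  have hb : 0 < z / (2 * m) := by positivity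
  have hrep (p : EuclideanSpace ℝ (Fin d)) :
      exp (-(z / m) * √(m ^ 2 + ‖p‖ ^ 2)) / √(m ^ 2 + ‖p‖ ^ 2)
        = (√π)⁻¹ * ∫ t : ℝ, exp (-((m ^ 2 + ‖p‖ ^ 2) * exp t + (z / (2 * m)) ^ 2 * exp (-t)))
          * exp (1 / 2 * t) := by
    have h := exp_neg_mul_div_eq_integral
      (show 0 < √(m ^ 2 + ‖p‖ ^ 2) by positivity) hb
    rw [sq_sqrt (by positivity)] at h
    rw [← h]
    congr 4
    field_simp
  simp_rw [hrep]
  rw [integral_const_mul, integral_integral_exp_neg_add_norm_sq (by positivity) (by positivity),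
    finrank_euclideanSpace_fin,
    show (1 / 2 - d / 2 : ℝ) = -((d - 1) / 2) by ring,
    integral_exp_neg_exp_add_exp_neg hm hb, besselK_neg,
    show 2 * m * (z / (2 * m)) = z by field_simp,
    show 2 * π * m ^ 2 / z = π * (z / (2 * m) / m)⁻¹ by field_simp,
    mul_rpow pi_pos.le (by positivity), inv_rpow (by positivity), ← rpow_neg (by positivity),
    show (d / 2 : ℝ) = (d - 1) / 2 + 1 / 2 by ring, rpow_add pi_pos, ← sqrt_eq_rpow]
  have hπ : √π ≠ 0 := by positivity
  field_simp
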